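/- arXiv:1807.02289 — 2 statements merged into one kernel-verified Lean document; each statement's English description precedes it below -/
import Mathlib

section
/- Let p ≥ 1 and let L be a lattice with 𝔼^p ⊆ L ⊆ ℤ^p. For s ∈ ℕ^p with s_k ≥ 1 and u ∈ ℤ^p write m(L,s,u) = |L ∩ ∏_{k=1}^p {u_k, u_k+1, …, u_k+s_k−1}|. For K ⊆ {1,…,p} let s_K be the p-vector with (s_K)_k = 2 for k ∈ K and (s_K)_k = 1 for k ∉ K. Then for every s and u, m(L,s,u) = Σ_{K ⊆ {1,…,p}} m(L, s_K, u) · ∏_{k ∈ K} ⌊s_k/2⌋ · ∏_{k ∉ K} (s_k − 2⌊s_k/2⌋). -/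
/-- The number of integers among `u, …, u + n - 1` whose residue modulo `2` is `r`. -/
noncomputable def residueCount (u : ℤ) (n : ℕ) (r : ZMod 2) : ℕ :=
  ((Finset.Ico u (u + n)).filter fun j : ℤ => (j : ZMod 2) = r).card

theorem residueCount_zero (u : ℤ) (r : ZMod 2) : residueCount u 0 r = 0 := by
  simp [residueCount]

theorem residueCount_succ (u : ℤ) (n : ℕ) (r : ZMod 2) :
    residueCount u (n + 1) r = residueCount u n r + if (u : ZMod 2) + n = r then 1 else 0 := by
  have h : Finset.Ico u (u + (n + 1 : ℕ)) = insert (u + n : ℤ) (Finset.Ico u (u + n)) := by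
    ext j
    simp only [Finset.mem_Ico, Finset.mem_insert]
    omega
  unfold residueCount
  rw [h, Finset.filter_insert]
  split_ifs with h₁ h₂ h₂
  · rw [Finset.card_insert_of_notMem (by simp)]
  · exact absurd (by simpa using h₁) h₂
  · exact absurd (by simpa using h₂) h₁
  · rfl

theorem residueCount_add_two (u : ℤ) (n : ℕ) (r : ZMod 2) :
    residueCount u (n + 2) r = residueCount u n r + 1 := by
  have h : ∀ a r : ZMod 2,
      ((if a = r then 1 else 0) + if a + 1 = r then 1 else 0) = 1 := by decide
  rw [residueCount_succ, residueCount_succ, Nat.cast_add, Nat.cast_one,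
    ← add_assoc (u : ZMod 2), add_assoc (residueCount u n r), h]

theorem residueCount_eq (u : ℤ) (n : ℕ) (r : ZMod 2) :
    residueCount u n r =
      n / 2 * residueCount u 2 r + (n - 2 * (n / 2)) * residueCount u 1 r := by
  have h₂ : residueCount u 2 r = 1 := by
    simpa [residueCount_zero] using residueCount_add_two u 0 r
  induction n using Nat.twoStepInduction with
  | zero => simp [residueCount_zero]
  | one => simp
  | more n ih _ =>
    have h : n + 2 - 2 * (n / 2 + 1) = n - 2 * (n / 2) := by omega
    rw [residueCount_add_two, ih, h₂, Nat.add_div_right n two_pos, h]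
    ring

section BoxCount

variable {ι : Type*}

theorem mem_iff_val_cast_mem {L : AddSubgroup (ι → ℤ)}
    (hE : ∀ x : ι → ℤ, (∀ k, Even (x k)) → x ∈ L) {x : ι → ℤ} {r : ι → ZMod 2}
    (h : ∀ k, (x k : ZMod 2) = r k) : x ∈ L ↔ (fun k => ((r k).val : ℤ)) ∈ L := by
  have hd : x - (fun k => ((r k).val : ℤ)) ∈ L := hE _ fun k => by
    rw [even_iff_two_dvd]
    exact (ZMod.intCast_zmod_eq_zero_iff_dvd _ 2).1 (by simp [h k])
  constructor <;> intro hx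
  · simpa using L.sub_mem hx hd
  · simpa using L.add_mem hd hx

variable [Fintype ι]

open Classical in
/-- Counting the points of a lattice containing all even points in a box, by residue class. -/
theorem ncard_box_eq_sum {L : AddSubgroup (ι → ℤ)}
    (hE : ∀ x : ι → ℤ, (∀ k, Even (x k)) → x ∈ L) (u : ι → ℤ) (n : ι → ℕ) :
    Set.ncard {x : ι → ℤ | x ∈ L ∧ ∀ k, u k ≤ x k ∧ x k < u k + n k} =
      ∑ r : ι → ZMod 2, if (fun k => ((r k).val : ℤ)) ∈ L
        then ∏ k, residueCount (u k) (n k) (r k) else 0 := by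
  have hset : {x : ι → ℤ | x ∈ L ∧ ∀ k, u k ≤ x k ∧ x k < u k + n k} =
      ((Fintype.piFinset fun k => Finset.Ico (u k) (u k + n k)).filter (· ∈ L) :
        Finset (ι → ℤ)) := by
    ext x
    simp [and_comm]
  rw [hset, Set.ncard_coe_finset,
    Finset.card_eq_sum_card_fiberwise (f := fun x k => (x k : ZMod 2)) (t := Finset.univ)
      (by simp)]
  refine Finset.sum_congr rfl fun r _ => ?_
  split_ifs with hr
  · simp only [residueCount]
    rw [← Fintype.card_piFinset]
    refine congrArg Finset.card (Finset.ext fun x => ?_)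
    simp only [Finset.mem_filter, Fintype.mem_piFinset, funext_iff, forall_and]
    exact ⟨fun h => ⟨h.1.1, h.2⟩, fun h => ⟨⟨h.1, (mem_iff_val_cast_mem hE h.2).2 hr⟩, h.2⟩⟩
  · rw [Finset.card_eq_zero, Finset.filter_eq_empty_iff]
    intro x hx hxr
    exact hr ((mem_iff_val_cast_mem hE (congrFun hxr)).1 (Finset.mem_filter.1 hx).2)

theorem prod_residueCount_eq_sum [DecidableEq ι] (u : ι → ℤ) (s : ι → ℕ) (r : ι → ZMod 2) :
    ∏ k, residueCount (u k) (s k) (r k) =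
      ∑ K ∈ (Finset.univ : Finset ι).powerset,
        (∏ k, residueCount (u k) (if k ∈ K then 2 else 1) (r k)) *
          (∏ k ∈ K, s k / 2) * ∏ k ∈ Kᶜ, (s k - 2 * (s k / 2)) := by
  simp_rw [residueCount_eq _ (s _)]
  rw [Finset.prod_add]
  refine Finset.sum_congr rfl fun K _ => ?_
  have h₂ : ∏ k ∈ K, residueCount (u k) (if k ∈ K then 2 else 1) (r k) =
      ∏ k ∈ K, residueCount (u k) 2 (r k) :=
    Finset.prod_congr rfl fun k hk => by rw [if_pos hk]
  have h₁ : ∏ k ∈ Kᶜ, residueCount (u k) (if k ∈ K then 2 else 1) (r k) =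
      ∏ k ∈ Kᶜ, residueCount (u k) 1 (r k) :=
    Finset.prod_congr rfl fun k hk => by rw [if_neg (Finset.mem_compl.1 hk)]
  rw [← Finset.prod_mul_prod_compl K, h₁, h₂, ← Finset.compl_eq_univ_sdiff,
    Finset.prod_mul_distrib, Finset.prod_mul_distrib]
  ring

end BoxCount

/-- Box-count decomposition: for a lattice `L` with `𝔼^p ⊆ L ⊆ ℤ^p`, writing
`m(L,s,u)` for the number of points of `L` in `∏_k {u_k,…,u_k+s_k−1}`, one has
`m(L,s,u) = Σ_{K ⊆ {1,…,p}} m(L,s_K,u) · ∏_{k∈K} ⌊s_k/2⌋ · ∏_{k∉K} (s_k − 2⌊s_k/2⌋)`,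
where `s_K` has entries `2` on `K` and `1` off `K`. -/
theorem stmt_8 (p : ℕ) (hp : 1 ≤ p) (L : AddSubgroup (Fin p → ℤ))
    (hE : ∀ x : Fin p → ℤ, (∀ k, Even (x k)) → x ∈ L)
    (s : Fin p → ℕ) (hs : ∀ k, 1 ≤ s k) (u : Fin p → ℤ) :
    Set.ncard {x : Fin p → ℤ | x ∈ L ∧ ∀ k, u k ≤ x k ∧ x k < u k + s k} =
      ∑ K ∈ (Finset.univ : Finset (Fin p)).powerset,
        Set.ncard {x : Fin p → ℤ | x ∈ L ∧
            ∀ k, u k ≤ x k ∧ x k < u k + (if k ∈ K then (2 : ℕ) else 1)} *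
          (∏ k ∈ K, s k / 2) * (∏ k ∈ Kᶜ, (s k - 2 * (s k / 2))) := by
  classical
  simp_rw [ncard_box_eq_sum hE, Finset.sum_mul]
  rw [Finset.sum_comm]
  refine Finset.sum_congr rfl fun r _ => ?_
  split_ifs with hr
  · exact prod_residueCount_eq_sum u s r
  · simp
end

section
/- Let p ≥ 1, let L be a lattice with 𝔼^p ⊆ L ⊆ ℤ^p, and let K ⊆ {1,…,p}. Define L_K = {x restricted to the coordinates in K : x ∈ L and x_k = 0 for all k ∉ K}, a subgroup of ℤ^K containing 𝔼^K. Then for every u ∈ ℤ^p, the count |L ∩ (∏_{k ∈ K} {u_k, u_k+1} × ∏_{k ∉ K} {u_k})| is either 0 or equal to |L_K ∩ {0,1}^K|, and in particular |L ∩ (∏_{k ∈ K} {u_k, u_k+1} × ∏_{k ∉ K} {u_k})| ≤ |L ∩ (∏_{k ∈ K} {0,1} × ∏_{k ∉ K} {0})| = |L_K ∩ {0,1}^K|, with the maximum attained at u = 0_p. -/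
/-- Membership in a subgroup containing the even lattice only depends on parities. -/
theorem AddSubgroup.mem_of_even_sub {ι : Type*} {L : AddSubgroup (ι → ℤ)}
    (hE : ∀ x : ι → ℤ, (∀ k, Even (x k)) → x ∈ L) {x y : ι → ℤ} (hx : x ∈ L)
    (h : ∀ k, Even (y k - x k)) : y ∈ L := by
  simpa using L.add_mem hx (hE (y - x) h)

/-- A nonempty intersection of `L` with a translate of the unit box on the coordinates in `K` is
equinumerous to the intersection of `L` with the box itself. -/
theorem AddSubgroup.ncard_box_eq_of_mem {ι : Type*} {L : AddSubgroup (ι → ℤ)}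
    (hE : ∀ x : ι → ℤ, (∀ k, Even (x k)) → x ∈ L) {K : Set ι} {u y : ι → ℤ} (hy : y ∈ L)
    (hyu : ∀ k, (k ∈ K → (y k = u k ∨ y k = u k + 1)) ∧ (k ∉ K → y k = u k)) :
    Set.ncard {x : ι → ℤ | x ∈ L ∧
        ∀ k, (k ∈ K → (x k = u k ∨ x k = u k + 1)) ∧ (k ∉ K → x k = u k)} =
      Set.ncard {x : ι → ℤ | x ∈ L ∧
        ∀ k, (k ∈ K → (x k = 0 ∨ x k = 1)) ∧ (k ∉ K → x k = 0)} := by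
  have hsign : ∀ k, y k = u k ∨ y k = u k + 1 := fun k => by
    by_cases hk : k ∈ K
    · exact (hyu k).1 hk
    · exact Or.inl ((hyu k).2 hk)
  refine Set.ncard_congr (fun x _ k => (1 - 2 * (y k - u k)) * (x k - y k)) ?_ ?_ ?_
  · rintro x ⟨hx, hxu⟩
    refine ⟨mem_of_even_sub hE (L.sub_mem hx hy) fun k => ?_, fun k => ⟨fun hk => ?_, fun hk => ?_⟩⟩
    · exact ⟨-((y k - u k) * (x k - y k)), by simp only [Pi.sub_apply]; ring⟩
    · rcases (hyu k).1 hk with h | h <;> rcases (hxu k).1 hk with h' | h' <;> simp [h, h']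
    · simp [(hyu k).2 hk, (hxu k).2 hk]
  · intro a b _ _ hab
    funext k
    have h := congrFun hab k
    rcases hsign k with h' | h' <;> simp only [h'] at h <;> linarith
  · rintro z ⟨hz, hz'⟩
    refine ⟨fun k => y k + (1 - 2 * (y k - u k)) * z k, ⟨?_, fun k => ⟨fun hk => ?_, fun hk => ?_⟩⟩, ?_⟩
    · refine mem_of_even_sub hE (L.add_mem hy hz) fun k => ?_
      exact ⟨-((y k - u k) * z k), by simp only [Pi.add_apply]; ring⟩
    · rcases (hyu k).1 hk with h | h <;> rcases (hz' k).1 hk with h' | h' <;> simp [h, h']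
    · simp [(hyu k).2 hk, (hz' k).2 hk]
    · funext k
      rcases hsign k with h | h <;> simp only [h] <;> ring

/-- Restriction to `K` identifies the points of `L` in the unit box on `K` with the `0`-`1` vectors
of the section of `L` along `K`. -/
theorem AddSubgroup.ncard_unit_box_eq {ι : Type*} (L : AddSubgroup (ι → ℤ)) (K : Set ι) :
    Set.ncard {x : ι → ℤ | x ∈ L ∧
        ∀ k, (k ∈ K → (x k = 0 ∨ x k = 1)) ∧ (k ∉ K → x k = 0)} =
      Set.ncard {v : K → ℤ |
        (∃ x ∈ L, (∀ k, k ∉ K → x k = 0) ∧ ∀ k : K, x (k : ι) = v k) ∧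
        ∀ k : K, v k = 0 ∨ v k = 1} := by
  refine Set.ncard_congr (fun x _ k => x k) ?_ ?_ ?_
  · rintro x ⟨hx, hxK⟩
    exact ⟨⟨x, hx, fun k => (hxK k).2, fun _ => rfl⟩, fun k => (hxK k).1 k.2⟩
  · rintro a b ⟨_, ha⟩ ⟨_, hb⟩ hab
    funext k
    by_cases hk : k ∈ K
    · exact congrFun hab ⟨k, hk⟩
    · rw [(ha k).2 hk, (hb k).2 hk]
  · rintro v ⟨⟨x, hx, hx0, hxv⟩, hv⟩
    exact ⟨x, ⟨hx, fun k => ⟨fun hk => hxv ⟨k, hk⟩ ▸ hv ⟨k, hk⟩, hx0 k⟩⟩, funext hxv⟩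


/-- Projection lemma: for a lattice `L` with `𝔼^p ⊆ L ⊆ ℤ^p`, a set of
coordinates `K` and `L_K = {x|_K : x ∈ L, x_k = 0 for k ∉ K}`, the count of
points of `L` in the translated box `∏_{k∈K}{u_k,u_k+1} × ∏_{k∉K}{u_k}` is
either `0` or `|L_K ∩ {0,1}^K|`; in particular it is at most the count for
`u = 0`, which equals `|L_K ∩ {0,1}^K|`. -/
theorem stmt_9 (p : ℕ) (hp : 1 ≤ p) (L : AddSubgroup (Fin p → ℤ))
    (hE : ∀ x : Fin p → ℤ, (∀ k, Even (x k)) → x ∈ L)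
    (K : Set (Fin p)) (u : Fin p → ℤ) :
    (Set.ncard {x : Fin p → ℤ | x ∈ L ∧
          ∀ k, (k ∈ K → (x k = u k ∨ x k = u k + 1)) ∧ (k ∉ K → x k = u k)} = 0 ∨
      Set.ncard {x : Fin p → ℤ | x ∈ L ∧
          ∀ k, (k ∈ K → (x k = u k ∨ x k = u k + 1)) ∧ (k ∉ K → x k = u k)} =
        Set.ncard {v : K → ℤ |
          (∃ x ∈ L, (∀ k, k ∉ K → x k = 0) ∧ ∀ k : K, x (k : Fin p) = v k) ∧
          ∀ k : K, v k = 0 ∨ v k = 1}) ∧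
    Set.ncard {x : Fin p → ℤ | x ∈ L ∧
        ∀ k, (k ∈ K → (x k = u k ∨ x k = u k + 1)) ∧ (k ∉ K → x k = u k)} ≤
      Set.ncard {x : Fin p → ℤ | x ∈ L ∧
        ∀ k, (k ∈ K → (x k = 0 ∨ x k = 1)) ∧ (k ∉ K → x k = 0)} ∧
    Set.ncard {x : Fin p → ℤ | x ∈ L ∧
        ∀ k, (k ∈ K → (x k = 0 ∨ x k = 1)) ∧ (k ∉ K → x k = 0)} =
      Set.ncard {v : K → ℤ |
        (∃ x ∈ L, (∀ k, k ∉ K → x k = 0) ∧ ∀ k : K, x (k : Fin p) = v k) ∧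
        ∀ k : K, v k = 0 ∨ v k = 1} := by
  rw [← AddSubgroup.ncard_unit_box_eq L K]
  rcases Set.eq_empty_or_nonempty {x : Fin p → ℤ | x ∈ L ∧
      ∀ k, (k ∈ K → (x k = u k ∨ x k = u k + 1)) ∧ (k ∉ K → x k = u k)} with h | ⟨y, hy, hyu⟩
  · simp [h]
  · have h := AddSubgroup.ncard_box_eq_of_mem hE hy hyu
    exact ⟨Or.inr h, h.le, rfl⟩
end
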